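/- Let X be a complex Banach space, p > 0, Ω ⊂ ℂ open, and let F : Ω → B(X) be analytic with F(λ) a finite rank operator for every λ ∈ Ω. Then the map λ ↦ det_p(I−F(λ)) is analytic on Ω. -/

import Mathlib

open scoped ENNReal

variable {X : Type*} [NormedAddCommGroup X] [NormedSpace ℂ X] [CompleteSpace X]

/-- A continuous linear operator has finite rank. -/
def IsFiniteRank (F : X →L[ℂ] X) : Prop :=
  FiniteDimensional ℂ (LinearMap.range (F : X →ₗ[ℂ] X))

/-- `det(I - F)`, defined as the determinant of the restriction of `I - F` to the
(finite-dimensional) range of `F`. -/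
noncomputable def detOneSub (F : X →L[ℂ] X) : ℂ :=
  LinearMap.det
    ((LinearMap.id : LinearMap.range (F : X →ₗ[ℂ] X) →ₗ[ℂ] LinearMap.range (F : X →ₗ[ℂ] X)) -
      (F : X →ₗ[ℂ] X).restrict fun x _ => LinearMap.mem_range_self _ x)

/-- `tr F`, the trace of the restriction of `F` to its range. -/
noncomputable def trOn (F : X →L[ℂ] X) : ℂ :=
  LinearMap.trace ℂ (LinearMap.range (F : X →ₗ[ℂ] X))
    ((F : X →ₗ[ℂ] X).restrict fun x _ => LinearMap.mem_range_self _ x)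

/-- The `p`-regularized determinant `det_p(I-F)` of a finite rank operator. -/
noncomputable def detp (p : ℝ) (F : X →L[ℂ] X) : ℂ :=
  detOneSub F * Complex.exp (∑ k ∈ Finset.Icc 1 (⌈p⌉₊ - 1), trOn (F ^ k) / (k : ℂ))

open Module Filter Topology

/-- The trace of a power of an endomorphism is the corresponding power sum of the roots of the
characteristic polynomial. -/
lemma trace_pow_eq_sum_roots_charpoly {V : Type*} [AddCommGroup V] [Module ℂ V]
    [FiniteDimensional ℂ V] (T : Module.End ℂ V) (k : ℕ) :
    LinearMap.trace ℂ V (T ^ k) = (T.charpoly.roots.map (· ^ k)).sum := by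
  classical
  have hds := DirectSum.isInternal_submodule_of_iSupIndep_of_iSup_eq_top
    T.independent_maxGenEigenspace T.iSup_maxGenEigenspace_eq_top
  have hfin : {μ | T.maxGenEigenspace μ ≠ ⊥}.Finite :=
    WellFoundedGT.finite_ne_bot_of_iSupIndep T.independent_maxGenEigenspace
  have hT : ∀ j : ℕ, ∀ μ, Set.MapsTo (T ^ j) (T.maxGenEigenspace μ) (T.maxGenEigenspace μ) :=
    fun j => T.mapsTo_maxGenEigenspace_of_comm (Commute.pow_right rfl j)
  have key : ∀ μ, ∀ j : ℕ, LinearMap.trace ℂ _ ((T ^ j).restrict (hT j μ)) =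
      T.charpoly.rootMultiplicity μ * μ ^ j := by
    intro μ j
    induction j with
    | zero =>
      have h1 : ((T ^ 0).restrict (hT 0 μ)) = LinearMap.id := by ext; simp
      rw [h1, LinearMap.trace_id, LinearMap.finrank_maxGenEigenspace_eq]
      simp
    | succ j ih =>
      have h1 : (T ^ (j + 1)).restrict (hT (j + 1) μ) = (T ^ j).restrict (hT j μ) ∘ₗ
          T.restrict (T.mapsTo_maxGenEigenspace_of_comm rfl μ) := by
        ext x
        simp only [LinearMap.coe_restrict_apply, pow_succ, Module.End.mul_apply]
        rfl
      have hc : Commute ((T ^ j).restrict (hT j μ))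
          (T.restrict (T.mapsTo_maxGenEigenspace_of_comm rfl μ)) :=
        LinearMap.restrict_commute (Commute.pow_left rfl j) _ _
      rw [h1, LinearMap.trace_comp_eq_mul_of_commute_of_isNilpotent μ hc
        (T.isNilpotent_restrict_maxGenEigenspace_sub_algebraMap μ), ih]
      ring
  rw [LinearMap.trace_eq_sum_trace_restrict' hds hfin (hT k), Finset.sum_multiset_map_count]
  simp only [key, nsmul_eq_mul, Polynomial.count_roots]
  refine Finset.sum_congr ?_ fun _ _ => rfl
  ext μ
  rw [Set.Finite.mem_toFinset, Multiset.mem_toFinset, Polynomial.mem_roots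
    T.charpoly_monic.ne_zero, ← Module.End.hasEigenvalue_iff_isRoot_charpoly]
  simp only [Set.mem_ofPred_eq, ne_eq, ← Submodule.finrank_eq_zero,
    LinearMap.finrank_maxGenEigenspace_eq, Module.End.hasEigenvalue_iff_isRoot_charpoly,
    ← Polynomial.rootMultiplicity_pos T.charpoly_monic.ne_zero]
  omega

lemma det_one_sub_eq_prod_roots_charpoly {V : Type*} [AddCommGroup V] [Module ℂ V]
    [FiniteDimensional ℂ V] (T : Module.End ℂ V) :
    LinearMap.det (LinearMap.id - T) = (T.charpoly.roots.map (1 - ·)).prod := by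
  have h := LinearMap.eval_charpoly T 1
  rw [map_one] at h
  change LinearMap.det (1 - T) = _
  rw [← h]
  conv_lhs => rw [(IsAlgClosed.splits T.charpoly).eq_prod_roots_of_monic T.charpoly_monic]
  rw [Polynomial.eval_multiset_prod, Multiset.map_map]
  simp

/-- A multiset of complex numbers of cardinality at most `n` padded with zeros to an `n`-tuple. -/
lemma exists_tuple_of_card_le (s : Multiset ℂ) {n : ℕ} (hs : s.card ≤ n) :
    ∃ l : Fin n → ℂ, (Finset.univ.val.map l) = s + Multiset.replicate (n - s.card) 0 := by
  set t := s + Multiset.replicate (n - s.card) 0 with ht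
  have hn : t.toList.length = n := by
    simp only [Multiset.length_toList, ht, Multiset.card_add, Multiset.card_replicate]
    omega
  clear_value t
  subst hn
  exact ⟨t.toList.get, by rw [Fin.univ_val_map, List.ofFn_get, Multiset.coe_toList]⟩

/-- Newton's identities: if all power sums of a tuple depend analytically on a parameter,
so does `∏ (1 - l i)`. -/
lemma analyticAt_prod_one_sub_of_psum {n : ℕ} {l : ℂ → Fin n → ℂ} {z₀ : ℂ}
    (h : ∀ k, 0 < k → AnalyticAt ℂ (fun z => ∑ i, l z i ^ k) z₀) :
    AnalyticAt ℂ (fun z => ∏ i, (1 - l z i)) z₀ := by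
  have he : ∀ k, AnalyticAt ℂ
      (fun z => MvPolynomial.aeval (l z) (MvPolynomial.esymm (Fin n) ℂ k)) z₀ := by
    intro k
    induction k using Nat.strong_induction_on with
    | _ k ih =>
      rcases Nat.eq_zero_or_pos k with rfl | hk
      · simp [MvPolynomial.esymm_zero, analyticAt_const]
      have hk' : (k : ℂ) ≠ 0 := by exact_mod_cast hk.ne'
      have heq : (fun z => MvPolynomial.aeval (l z) (MvPolynomial.esymm (Fin n) ℂ k)) =
          fun z => (k : ℂ)⁻¹ * ((-1) ^ (k + 1) *
            ∑ a ∈ Finset.HasAntidiagonal.antidiagonal k with a.1 < k, (-1) ^ a.1 *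
              MvPolynomial.aeval (l z) (MvPolynomial.esymm (Fin n) ℂ a.1) *
              ∑ i, l z i ^ a.2) := by
        funext z
        have := congrArg (MvPolynomial.aeval (l z)) (MvPolynomial.mul_esymm_eq_sum (Fin n) ℂ k)
        rw [eq_inv_mul_iff_mul_eq₀ hk']
        simpa [MvPolynomial.psum] using this
      rw [heq]
      refine analyticAt_const.mul (analyticAt_const.mul
        (Finset.analyticAt_fun_sum _ fun a ha => ?_))
      simp only [Finset.mem_filter, Finset.HasAntidiagonal.mem_antidiagonal] at ha
      exact (analyticAt_const.mul (ih a.1 ha.2)).mul (h a.2 (by omega))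
  have heq : (fun z => ∏ i, (1 - l z i)) = fun z => ∑ j ∈ Finset.range (n + 1), (-1) ^ j *
      MvPolynomial.aeval (l z) (MvPolynomial.esymm (Fin n) ℂ j) := by
    funext z
    have := congrArg (Polynomial.eval 1)
      (Multiset.prod_X_sub_X_eq_sum_esymm (Finset.univ.val.map (l z)))
    rw [Polynomial.eval_multiset_prod, Polynomial.eval_finsetSum, Multiset.map_map,
      Multiset.map_map, Finset.prod_map_val] at this
    simpa [MvPolynomial.aeval_esymm_eq_multiset_esymm] using this
  rw [heq]
  exact Finset.analyticAt_fun_sum _ fun j _ => analyticAt_const.mul (he j)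

lemma analyticAt_matrix_det {n : ℕ} {A : ℂ → Matrix (Fin n) (Fin n) ℂ} {z₀ : ℂ}
    (h : ∀ i j, AnalyticAt ℂ (fun z => A z i j) z₀) : AnalyticAt ℂ (fun z => (A z).det) z₀ := by
  simp only [Matrix.det_apply']
  exact Finset.analyticAt_fun_sum _ fun σ _ => analyticAt_const.mul
    (Finset.analyticAt_fun_prod _ fun i _ => h _ _)

lemma analyticAt_trace_inv_mul {n : ℕ} {A B : ℂ → Matrix (Fin n) (Fin n) ℂ} {z₀ : ℂ}
    (hA : ∀ i j, AnalyticAt ℂ (fun z => A z i j) z₀)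
    (hB : ∀ i j, AnalyticAt ℂ (fun z => B z i j) z₀) (hdet : (A z₀).det ≠ 0) :
    AnalyticAt ℂ (fun z => ((A z)⁻¹ * B z).trace) z₀ := by
  have hadj : ∀ i j, AnalyticAt ℂ (fun z => (A z).adjugate i j) z₀ := by
    intro i j
    simp only [Matrix.adjugate_apply]
    refine analyticAt_matrix_det fun a b => ?_
    by_cases hab : a = j
    · subst hab
      simp [analyticAt_const]
    · simpa [Matrix.updateRow_ne hab] using hA a b
  simp only [Matrix.trace, Matrix.diag, Matrix.mul_apply, Matrix.inv_def, Matrix.smul_apply,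
    Ring.inverse_eq_inv', smul_eq_mul]
  exact Finset.analyticAt_fun_sum _ fun i _ => Finset.analyticAt_fun_sum _ fun j _ =>
    (((analyticAt_matrix_det hA).fun_inv hdet).mul (hadj i j)).mul (hB j i)

section FiniteRank

variable {E : Type*} [NormedAddCommGroup E] [NormedSpace ℂ E]

lemma trOn_eq_trace_restrict {F : E →L[ℂ] E} (W : Submodule ℂ E) [FiniteDimensional ℂ W]
    (hW : ∀ x, F x ∈ W) :
    trOn F = LinearMap.trace ℂ W ((F : E →ₗ[ℂ] E).restrict fun x _ => hW x) := by
  have hle : LinearMap.range (F : E →ₗ[ℂ] E) ≤ W := by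
    rintro _ ⟨x, rfl⟩
    exact hW x
  have : FiniteDimensional ℂ (LinearMap.range (F : E →ₗ[ℂ] E)) :=
    Submodule.finiteDimensional_of_le hle
  exact LinearMap.trace_comp_comm' (Submodule.inclusion hle)
    ((F : E →ₗ[ℂ] E).rangeRestrict ∘ₗ W.subtype)

lemma trOn_sub {F G : E →L[ℂ] E} (hF : IsFiniteRank F) (hG : IsFiniteRank G) :
    trOn (F - G) = trOn F - trOn G := by
  have : FiniteDimensional ℂ (LinearMap.range (F : E →ₗ[ℂ] E)) := hF
  have : FiniteDimensional ℂ (LinearMap.range (G : E →ₗ[ℂ] E)) := hG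
  let W := LinearMap.range (F : E →ₗ[ℂ] E) ⊔ LinearMap.range (G : E →ₗ[ℂ] E)
  have h1 : ∀ x, F x ∈ W := fun x => Submodule.mem_sup_left ⟨x, rfl⟩
  have h2 : ∀ x, G x ∈ W := fun x => Submodule.mem_sup_right ⟨x, rfl⟩
  rw [trOn_eq_trace_restrict W h1, trOn_eq_trace_restrict W h2,
    trOn_eq_trace_restrict W (F := F - G) fun x => W.sub_mem (h1 x) (h2 x), ← map_sub]
  rfl

lemma trOn_pow {F : E →L[ℂ] E} (hF : IsFiniteRank F) {k : ℕ} (hk : 0 < k) :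
    trOn (F ^ k) = LinearMap.trace ℂ _
      (((F : E →ₗ[ℂ] E).restrict fun x _ => LinearMap.mem_range_self (F : E →ₗ[ℂ] E) x) ^ k) := by
  have : FiniteDimensional ℂ (LinearMap.range (F : E →ₗ[ℂ] E)) := hF
  obtain ⟨j, rfl⟩ := Nat.exists_eq_succ_of_ne_zero hk.ne'
  rw [trOn_eq_trace_restrict (LinearMap.range (F : E →ₗ[ℂ] E))
    fun x => ⟨(F ^ j) x, by simp [pow_succ']⟩, Module.End.pow_restrict]
  congr 1
  ext x
  simp

/-- A finite rank operator has a list of eigenvalues that determines its determinant and the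
traces of all its powers. -/
lemma exists_eigenvalues {F : E →L[ℂ] E} (hF : IsFiniteRank F) {n : ℕ}
    (hn : finrank ℂ (LinearMap.range (F : E →ₗ[ℂ] E)) ≤ n) :
    ∃ l : Fin n → ℂ, (∀ i, ‖l i‖ ≤ ‖F‖) ∧ detOneSub F = ∏ i, (1 - l i) ∧
      ∀ k, 0 < k → trOn (F ^ k) = ∑ i, l i ^ k := by
  have : FiniteDimensional ℂ (LinearMap.range (F : E →ₗ[ℂ] E)) := hF
  set T : Module.End ℂ (LinearMap.range (F : E →ₗ[ℂ] E)) :=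
    (F : E →ₗ[ℂ] E).restrict fun x _ => LinearMap.mem_range_self (F : E →ₗ[ℂ] E) x with hT
  have hcard : T.charpoly.roots.card ≤ n :=
    (Polynomial.card_roots' _).trans (T.charpoly_natDegree.trans_le hn)
  obtain ⟨l, hl⟩ := exists_tuple_of_card_le _ hcard
  refine ⟨l, fun i => ?_, ?_, fun k hk => ?_⟩
  · have hi : l i ∈ Finset.univ.val.map l := Multiset.mem_map_of_mem _ (Finset.mem_univ i)
    rw [hl, Multiset.mem_add] at hi
    rcases hi with hi | hi
    · rw [Polynomial.mem_roots T.charpoly_monic.ne_zero,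
        ← Module.End.hasEigenvalue_iff_isRoot_charpoly] at hi
      obtain ⟨v, hv⟩ := hi.exists_hasEigenvector
      have h1 : F (v : E) = l i • (v : E) := congrArg Subtype.val hv.apply_eq_smul
      have h2 : 0 < ‖(v : E)‖ := norm_pos_iff.mpr fun h => hv.2 (Subtype.ext h)
      have h3 := F.le_opNorm (v : E)
      rw [h1, norm_smul] at h3
      exact le_of_mul_le_mul_right h3 h2
    · rw [Multiset.eq_of_mem_replicate hi]
      simp
  · have h := congrArg (fun s => (s.map (1 - ·)).prod) hl
    simp only [Multiset.map_map, Multiset.map_add, Multiset.prod_add, Multiset.map_replicate,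
      sub_zero, Multiset.prod_replicate, one_pow, mul_one] at h
    rw [detOneSub, ← hT, det_one_sub_eq_prod_roots_charpoly, ← h]
    rfl
  · have h := congrArg (fun s => (s.map (· ^ k)).sum) hl
    simp only [Multiset.map_map, Multiset.map_add, Multiset.sum_add, Multiset.map_replicate,
      zero_pow hk.ne', Multiset.sum_replicate, smul_zero, add_zero] at h
    rw [trOn_pow hF hk, trace_pow_eq_sum_roots_charpoly, ← h]
    rfl

lemma norm_trOn_le {F : E →L[ℂ] E} (hF : IsFiniteRank F) {n : ℕ}
    (hn : finrank ℂ (LinearMap.range (F : E →ₗ[ℂ] E)) ≤ n) : ‖trOn F‖ ≤ n * ‖F‖ := by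
  obtain ⟨l, hl, -, htr⟩ := exists_eigenvalues hF hn
  have h := htr 1 one_pos
  simp only [pow_one] at h
  rw [h]
  refine (norm_sum_le _ _).trans ((Finset.sum_le_card_nsmul _ _ _ fun i _ => hl i).trans ?_)
  simp

/-- The trace is continuous along finite rank operators of bounded rank. -/
lemma continuousAt_trOn {f : ℂ → E →L[ℂ] E} {z₀ : ℂ} {n : ℕ} (hf : ContinuousAt f z₀)
    (hfr : ∀ᶠ z in 𝓝 z₀, IsFiniteRank (f z) ∧
      finrank ℂ (LinearMap.range (f z : E →ₗ[ℂ] E)) ≤ n) :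
    ContinuousAt (fun z => trOn (f z)) z₀ := by
  have h0 := hfr.self_of_nhds
  rw [ContinuousAt, tendsto_iff_norm_sub_tendsto_zero]
  have hlim : Tendsto (fun z => ((n + n : ℕ) : ℝ) * ‖f z - f z₀‖) (𝓝 z₀) (𝓝 0) := by
    simpa using (tendsto_iff_norm_sub_tendsto_zero.mp hf).const_mul ((n + n : ℕ) : ℝ)
  refine squeeze_zero' (Eventually.of_forall fun _ => norm_nonneg _) ?_ hlim
  filter_upwards [hfr] with z hz
  have : FiniteDimensional ℂ (LinearMap.range (f z : E →ₗ[ℂ] E)) := hz.1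
  have : FiniteDimensional ℂ (LinearMap.range (f z₀ : E →ₗ[ℂ] E)) := h0.1
  have hle : LinearMap.range ((f z - f z₀ : E →L[ℂ] E) : E →ₗ[ℂ] E) ≤
      LinearMap.range (f z : E →ₗ[ℂ] E) ⊔ LinearMap.range (f z₀ : E →ₗ[ℂ] E) := by
    rintro _ ⟨x, rfl⟩
    exact Submodule.sub_mem _ (Submodule.mem_sup_left ⟨x, rfl⟩)
      (Submodule.mem_sup_right ⟨x, rfl⟩)
  rw [← trOn_sub hz.1 h0.1]
  exact norm_trOn_le (Submodule.finiteDimensional_of_le hle)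
    ((Submodule.finrank_mono hle).trans
      ((Submodule.finrank_add_le_finrank_add_finrank _ _).trans (add_le_add hz.2 h0.2)))

lemma linearIndependent_of_det_ne_zero {n : ℕ} {v : Fin n → E} {φ : Fin n → E →L[ℂ] ℂ}
    (h : (Matrix.of fun i j => φ i (v j)).det ≠ 0) : LinearIndependent ℂ v := by
  rw [Fintype.linearIndependent_iff]
  intro c hc
  have h0 : (Matrix.of fun i j => φ i (v j)).mulVec c = 0 := by
    funext i
    have := congrArg (φ i) hc
    simpa [Matrix.mulVec, dotProduct, mul_comm] using this
  exact congrFun (Matrix.eq_zero_of_mulVec_eq_zero h h0)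

/-- A finite rank operator of rank at least `n` has a nonvanishing minor of size `n`. -/
lemma exists_minor_ne_zero {F : E →L[ℂ] E} (hF : IsFiniteRank F) {n : ℕ}
    (hn : n ≤ finrank ℂ (LinearMap.range (F : E →ₗ[ℂ] E))) :
    ∃ (x : Fin n → E) (φ : Fin n → E →L[ℂ] ℂ),
      (Matrix.of fun i j => φ i (F (x j))).det ≠ 0 := by
  have : FiniteDimensional ℂ (LinearMap.range (F : E →ₗ[ℂ] E)) := hF
  let b := finBasis ℂ (LinearMap.range (F : E →ₗ[ℂ] E))
  have hx : ∀ j, ∃ x, F x = b j := fun j => (b j).2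
  choose x hx using hx
  have hφ : ∀ i, ∃ φ : E →L[ℂ] ℂ,
      (φ : E →ₗ[ℂ] ℂ) ∘ₗ (LinearMap.range (F : E →ₗ[ℂ] E)).subtype = b.coord i := fun i =>
    (SeparatingDual.dualMap_surjective_iff (R := ℂ)
      (f := (LinearMap.range (F : E →ₗ[ℂ] E)).subtype)).mpr Subtype.val_injective (b.coord i)
  choose φ hφ using hφ
  refine ⟨fun j => x (Fin.castLE hn j), fun i => φ (Fin.castLE hn i), ?_⟩
  have h1 : (Matrix.of fun i j => φ (Fin.castLE hn i) (F (x (Fin.castLE hn j)))) = 1 := by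
    ext i j
    have := LinearMap.congr_fun (hφ (Fin.castLE hn i)) (b (Fin.castLE hn j))
    simp only [LinearMap.comp_apply, Submodule.subtype_apply] at this
    rw [Matrix.of_apply, hx]
    refine this.trans ?_
    simp [Finsupp.single_apply, Matrix.one_apply, eq_comm]
  simp [h1]

/-- The trace in terms of a nonvanishing minor of maximal size. -/
lemma trOn_eq_trace_inv_mul {F : E →L[ℂ] E} (hF : IsFiniteRank F) {n : ℕ}
    (hn : finrank ℂ (LinearMap.range (F : E →ₗ[ℂ] E)) ≤ n)
    {x : Fin n → E} {φ : Fin n → E →L[ℂ] ℂ}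
    (h : (Matrix.of fun i j => φ i (F (x j))).det ≠ 0) :
    trOn F = ((Matrix.of fun i j => φ i (F (x j)))⁻¹ *
      Matrix.of fun i j => φ i (F (F (x j)))).trace := by
  have : FiniteDimensional ℂ (LinearMap.range (F : E →ₗ[ℂ] E)) := hF
  let v : Fin n → LinearMap.range (F : E →ₗ[ℂ] E) := fun j => ⟨F (x j), x j, rfl⟩
  have hv : LinearIndependent ℂ v :=
    LinearIndependent.of_comp (LinearMap.range (F : E →ₗ[ℂ] E)).subtype
      (linearIndependent_of_det_ne_zero h)
  have hcard : Fintype.card (Fin n) = finrank ℂ (LinearMap.range (F : E →ₗ[ℂ] E)) :=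
    le_antisymm hv.fintype_card_le_finrank (by simpa using hn)
  rcases Nat.eq_zero_or_pos n with rfl | hpos
  · have := norm_trOn_le hF hn
    simpa using this
  have : Nonempty (Fin n) := ⟨⟨0, hpos⟩⟩
  let b := basisOfLinearIndependentOfCardEqFinrank hv hcard
  have hb : ∀ j, b j = v j := fun j => by simp [b]
  rw [trOn, LinearMap.trace_eq_matrix_trace ℂ b]
  congr 1
  set T : Module.End ℂ (LinearMap.range (F : E →ₗ[ℂ] E)) :=
    (F : E →ₗ[ℂ] E).restrict fun x _ => LinearMap.mem_range_self (F : E →ₗ[ℂ] E) x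
  have hmul : (Matrix.of fun i j => φ i (F (x j))) * LinearMap.toMatrix b b T =
      Matrix.of fun i j => φ i (F (F (x j))) := by
    ext i j
    have h1 := congrArg (fun w : LinearMap.range (F : E →ₗ[ℂ] E) => φ i (w : E))
      (b.sum_repr (T (b j)))
    simp only [hb] at h1
    have h2 : φ i (T (v j) : E) = φ i (F (F (x j))) := rfl
    rw [h2] at h1
    simp only [Matrix.mul_apply, Matrix.of_apply, LinearMap.toMatrix_apply, hb]
    rw [← h1]
    simp [v, mul_comm]
  rw [← hmul, ← Matrix.mul_assoc, Matrix.nonsing_inv_mul _ (isUnit_iff_ne_zero.mpr h),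
    Matrix.one_mul]

lemma isFiniteRank_of_range_le {F G : E →L[ℂ] E} (hG : IsFiniteRank G)
    (h : LinearMap.range (F : E →ₗ[ℂ] E) ≤ LinearMap.range (G : E →ₗ[ℂ] E)) :
    IsFiniteRank F :=
  have : FiniteDimensional ℂ (LinearMap.range (G : E →ₗ[ℂ] E)) := hG
  Submodule.finiteDimensional_of_le h

lemma IsFiniteRank.pow {F : E →L[ℂ] E} (hF : IsFiniteRank F) {k : ℕ} (hk : 0 < k) :
    IsFiniteRank (F ^ k) := by
  obtain ⟨j, rfl⟩ := Nat.exists_eq_succ_of_ne_zero hk.ne'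
  refine isFiniteRank_of_range_le hF ?_
  rintro _ ⟨x, rfl⟩
  exact ⟨(F ^ j) x, by rw [pow_succ']; rfl⟩

lemma AnalyticAt.clm_apply {f : ℂ → E →L[ℂ] E} {g : ℂ → E} {z : ℂ} (hf : AnalyticAt ℂ f z)
    (hg : AnalyticAt ℂ g z) : AnalyticAt ℂ (fun w => f w (g w)) z :=
  (ContinuousLinearMap.analyticAt_bilinear (.id ℂ (E →L[ℂ] E)) (f z, g z)).comp₂ hf hg

lemma analyticAt_minor {f : ℂ → E →L[ℂ] E} {z : ℂ} (hf : AnalyticAt ℂ f z) {n : ℕ}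
    (x : Fin n → E) (φ : Fin n → E →L[ℂ] ℂ) :
    AnalyticAt ℂ (fun w => (Matrix.of fun i j => φ i (f w (x j))).det) z :=
  analyticAt_matrix_det fun i j =>
    ((φ i).analyticAt _).comp (hf.clm_apply analyticAt_const)

/-- If all `n + 1` minors of a finite rank operator vanish, its rank is at most `n`. -/
lemma finrank_le_of_minors_eq_zero {F : E →L[ℂ] E} (hF : IsFiniteRank F) {n : ℕ}
    (h : ∀ (x : Fin (n + 1) → E) (φ : Fin (n + 1) → E →L[ℂ] ℂ),
      (Matrix.of fun i j => φ i (F (x j))).det = 0) :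
    finrank ℂ (LinearMap.range (F : E →ₗ[ℂ] E)) ≤ n := by
  by_contra! hlt
  obtain ⟨x, φ, hx⟩ := exists_minor_ne_zero hF hlt
  exact hx (h x φ)

lemma minor_eq_zero_of_finrank_le {F : E →L[ℂ] E} (hF : IsFiniteRank F) {n : ℕ}
    (h : finrank ℂ (LinearMap.range (F : E →ₗ[ℂ] E)) ≤ n)
    (x : Fin (n + 1) → E) (φ : Fin (n + 1) → E →L[ℂ] ℂ) :
    (Matrix.of fun i j => φ i (F (x j))).det = 0 := by
  by_contra hne
  have : FiniteDimensional ℂ (LinearMap.range (F : E →ₗ[ℂ] E)) := hF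
  have hv : LinearIndependent ℂ
      (fun j => (⟨F (x j), x j, rfl⟩ : LinearMap.range (F : E →ₗ[ℂ] E))) :=
    LinearIndependent.of_comp (LinearMap.range (F : E →ₗ[ℂ] E)).subtype
      (linearIndependent_of_det_ne_zero hne)
  have := hv.fintype_card_le_finrank
  simp only [Fintype.card_fin] at this
  omega

/-- An analytic family of finite rank operators has bounded rank on a disc: by Baire's theorem
the minors of some size vanish on an open subset, hence everywhere by the identity theorem. -/
lemma exists_minors_eq_zero {f : ℂ → E →L[ℂ] E} {z₀ : ℂ} {r : ℝ} (hr : 0 < r)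
    (hf : AnalyticOnNhd ℂ f (Metric.closedBall z₀ r))
    (hfr : ∀ z ∈ Metric.closedBall z₀ r, IsFiniteRank (f z)) :
    ∃ n : ℕ, ∀ z ∈ Metric.ball z₀ r, ∀ (x : Fin n → E) (φ : Fin n → E →L[ℂ] ℂ),
      (Matrix.of fun i j => φ i (f z (x j))).det = 0 := by
  let S : Option ℕ → Set ℂ := fun o => o.elim (Metric.ball z₀ r)ᶜ fun n =>
    ⋂ (x : Fin (n + 1) → E) (φ : Fin (n + 1) → E →L[ℂ] ℂ), Metric.closedBall z₀ r ∩
      (fun w => (Matrix.of fun i j => φ i (f w (x j))).det) ⁻¹' {0}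
  have hclosed : ∀ o, IsClosed (S o) := by
    rintro (_ | n)
    · exact Metric.isOpen_ball.isClosed_compl
    · refine isClosed_iInter fun x => isClosed_iInter fun φ => ?_
      refine ContinuousOn.preimage_isClosed_of_isClosed (fun z hz => ?_)
        Metric.isClosed_closedBall isClosed_singleton
      exact (analyticAt_minor (hf z hz) x φ).continuousAt.continuousWithinAt
  have hcover : ⋃ o, S o = Set.univ := by
    refine Set.eq_univ_of_forall fun z => Set.mem_iUnion.mpr ?_
    by_cases hz : z ∈ Metric.ball z₀ r
    · have hz' := Metric.ball_subset_closedBall hz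
      exact ⟨some (finrank ℂ (LinearMap.range (f z : E →ₗ[ℂ] E))),
        Set.mem_iInter.mpr fun x => Set.mem_iInter.mpr fun φ =>
          ⟨hz', minor_eq_zero_of_finrank_le (hfr z hz') le_rfl x φ⟩⟩
    · exact ⟨none, hz⟩
  obtain ⟨z₁, hz₁, hball⟩ := (dense_iUnion_interior_of_closed hclosed hcover).exists_mem_open
    Metric.isOpen_ball (Metric.nonempty_ball.mpr hr : (Metric.ball z₀ r).Nonempty)
  obtain ⟨_ | n, hint⟩ := Set.mem_iUnion.mp hz₁
  · exact absurd hball (interior_subset hint)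
  refine ⟨n + 1, fun z hz x φ => ?_⟩
  refine AnalyticOnNhd.eqOn_zero_of_preconnected_of_eventuallyEq_zero
    (fun w hw => analyticAt_minor (hf w (Metric.ball_subset_closedBall hw)) x φ)
    (convex_ball z₀ r).isPreconnected hball ?_ hz
  filter_upwards [mem_interior_iff_mem_nhds.mp hint] with w hw
  exact (Set.mem_iInter.mp (Set.mem_iInter.mp hw x) φ).2

/-- Near a point, an analytic family of finite rank operators has rank at most some `n`, with a
minor of size `n` that does not vanish on a punctured neighbourhood. -/
lemma exists_generic_minor {Ω : Set ℂ} (hΩ : IsOpen Ω) {f : ℂ → E →L[ℂ] E}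
    (hf : AnalyticOnNhd ℂ f Ω) (hfr : ∀ z ∈ Ω, IsFiniteRank (f z)) {z₀ : ℂ} (hz₀ : z₀ ∈ Ω) :
    ∃ (n : ℕ) (x : Fin n → E) (φ : Fin n → E →L[ℂ] ℂ),
      (∀ᶠ z in 𝓝 z₀, finrank ℂ (LinearMap.range (f z : E →ₗ[ℂ] E)) ≤ n) ∧
      ∀ᶠ z in 𝓝[≠] z₀, (Matrix.of fun i j => φ i (f z (x j))).det ≠ 0 := by
  classical
  obtain ⟨r, hr, hball⟩ := Metric.nhds_basis_closedBall.mem_iff.mp (hΩ.mem_nhds hz₀)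
  have hex := exists_minors_eq_zero hr (hf.mono hball) fun z hz => hfr z (hball hz)
  obtain ⟨n, hn⟩ : ∃ n, Nat.find hex = n + 1 := by
    refine Nat.exists_eq_succ_of_ne_zero fun h0 => ?_
    have h1 := Nat.find_spec hex z₀ (Metric.mem_ball_self hr)
    rw [h0] at h1
    simpa using h1 0 0
  have hspec := Nat.find_spec hex
  rw [hn] at hspec
  have hmin := Nat.find_min hex (m := n) (by omega)
  push Not at hmin
  obtain ⟨z₁, hz₁, x, φ, hne⟩ := hmin
  refine ⟨n, x, φ, ?_, ?_⟩
  · filter_upwards [Metric.ball_mem_nhds z₀ hr] with z hz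
    exact finrank_le_of_minors_eq_zero (hfr z (hball (Metric.ball_subset_closedBall hz)))
      (hspec z hz)
  · refine (analyticAt_minor (hf z₀ hz₀) x φ).eventually_eq_zero_or_eventually_ne_zero.resolve_left
      fun h0 => hne ?_
    exact AnalyticOnNhd.eqOn_zero_of_preconnected_of_eventuallyEq_zero
      (fun w hw => analyticAt_minor (hf w (hball (Metric.ball_subset_closedBall hw))) x φ)
      (convex_ball z₀ r).isPreconnected (Metric.mem_ball_self hr) h0 hz₁

lemma analyticAt_trOn {Ω : Set ℂ} (hΩ : IsOpen Ω) {f : ℂ → E →L[ℂ] E}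
    (hf : AnalyticOnNhd ℂ f Ω) (hfr : ∀ z ∈ Ω, IsFiniteRank (f z)) {z₀ : ℂ} (hz₀ : z₀ ∈ Ω) :
    AnalyticAt ℂ (fun z => trOn (f z)) z₀ := by
  obtain ⟨n, x, φ, hrank, hne⟩ := exists_generic_minor hΩ hf hfr hz₀
  have hrank' : ∀ᶠ z in 𝓝 z₀, z ∈ Ω ∧
      finrank ℂ (LinearMap.range (f z : E →ₗ[ℂ] E)) ≤ n := Filter.Eventually.and (hΩ.mem_nhds hz₀) hrank
  refine Complex.analyticAt_of_differentiable_on_punctured_nhds_of_continuousAt ?_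
    (continuousAt_trOn (hf z₀ hz₀).continuousAt (hrank'.mono fun z hz => ⟨hfr z hz.1, hz.2⟩))
  filter_upwards [hne, hrank'.eventually_nhds.filter_mono nhdsWithin_le_nhds] with z hz hzr
  have hfz := hf z hzr.self_of_nhds.1
  have han := analyticAt_trace_inv_mul
    (A := fun w => Matrix.of fun i j => φ i (f w (x j)))
    (B := fun w => Matrix.of fun i j => φ i (f w (f w (x j))))
    (fun i j => ((φ i).analyticAt _).comp (hfz.clm_apply analyticAt_const))
    (fun i j => ((φ i).analyticAt _).comp (hfz.clm_apply (hfz.clm_apply analyticAt_const))) hz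
  refine (han.congr ?_).differentiableAt
  filter_upwards [hzr, (analyticAt_minor hfz x φ).continuousAt.eventually_ne hz] with w hw hw'
  exact (trOn_eq_trace_inv_mul (hfr w hw.1) hw.2 hw').symm

lemma analyticAt_trOn_pow {Ω : Set ℂ} (hΩ : IsOpen Ω) {f : ℂ → E →L[ℂ] E}
    (hf : AnalyticOnNhd ℂ f Ω) (hfr : ∀ z ∈ Ω, IsFiniteRank (f z)) {z₀ : ℂ} (hz₀ : z₀ ∈ Ω)
    {k : ℕ} (hk : 0 < k) : AnalyticAt ℂ (fun z => trOn (f z ^ k)) z₀ :=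
  analyticAt_trOn hΩ (f := fun z => f z ^ k) (fun z hz => (hf z hz).fun_pow k)
    (fun z hz => (hfr z hz).pow hk) hz₀

lemma analyticAt_detOneSub {Ω : Set ℂ} (hΩ : IsOpen Ω) {f : ℂ → E →L[ℂ] E}
    (hf : AnalyticOnNhd ℂ f Ω) (hfr : ∀ z ∈ Ω, IsFiniteRank (f z)) {z₀ : ℂ} (hz₀ : z₀ ∈ Ω) :
    AnalyticAt ℂ (fun z => detOneSub (f z)) z₀ := by
  obtain ⟨n, -, -, hrank, -⟩ := exists_generic_minor hΩ hf hfr hz₀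
  have hev : ∀ᶠ z in 𝓝 z₀, ∃ l : Fin n → ℂ, detOneSub (f z) = ∏ i, (1 - l i) ∧
      ∀ k, 0 < k → trOn (f z ^ k) = ∑ i, l i ^ k := by
    filter_upwards [hrank, hΩ.mem_nhds hz₀] with z hz hzΩ
    obtain ⟨l, -, h⟩ := exists_eigenvalues (hfr z hzΩ) hz
    exact ⟨l, h⟩
  obtain ⟨l, hl⟩ := hev.choice
  refine (analyticAt_prod_one_sub_of_psum (l := l) fun k hk => ?_).congr
    (hl.mono fun z hz => hz.1.symm)
  exact (analyticAt_trOn_pow hΩ hf hfr hz₀ hk).congr (hl.mono fun z hz => hz.2 k hk)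

end FiniteRank

/-- For `p > 0`, if `f : Ω → B(X)` is analytic on the open set `Ω ⊆ ℂ` and
takes finite rank values on `Ω`, then `z ↦ det_p(I - f z)` is analytic on `Ω`. -/
theorem analyticOnNhd_detp (p : ℝ) (hp : 0 < p) (Ω : Set ℂ) (hΩ : IsOpen Ω)
    (f : ℂ → X →L[ℂ] X) (hf : AnalyticOnNhd ℂ f Ω) (hfr : ∀ z ∈ Ω, IsFiniteRank (f z)) :
    AnalyticOnNhd ℂ (fun z => detp p (f z)) Ω := by
  intro z hz
  refine (analyticAt_detOneSub hΩ hf hfr hz).mul (AnalyticAt.cexp ?_)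
  refine Finset.analyticAt_fun_sum _ fun k hk => ?_
  exact (analyticAt_trOn_pow hΩ hf hfr hz (Finset.mem_Icc.mp hk).1).fun_div analyticAt_const
    (Nat.cast_ne_zero.mpr (Nat.one_le_iff_ne_zero.mp (Finset.mem_Icc.mp hk).1))
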